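/- For every b ∈ ℂ, as operators on N: X_m^{−1}∘Ẽ12(−m) − Ẽ12(−m)∘X_m^{−1} = q^{−m₁m₂}·X_m^{−1}∘(Ẽ11(0) − Ẽ22(0))∘X_m^{−1}. -/

import Mathlib

open MvPolynomial Finsupp

/-- The index set of the variables other than `x_m`. -/
abbrev NVar (m : ℤ × ℤ) := {p : ℤ × ℤ // p ≠ m}

/-- `N = ℂ[x_m, x_m^{−1}][x_n : n ≠ m]`, realized as finitely supported families,
indexed by the exponent of `x_m` (an arbitrary integer), of polynomials in the
variables `x_n`, `n ≠ m`. -/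
abbrev NN (m : ℤ × ℤ) := ℤ →₀ MvPolynomial (NVar m) ℂ

/-- Multiplication by `x_m^j` on `N` (for `j = -1` this is `X_m^{−1}`). -/
noncomputable def XmZ (m : ℤ × ℤ) (j : ℤ) (g : NN m) : NN m :=
  Finsupp.mapDomain (· + j) g

/-- Multiplication by `x_k` on `N` (the operator `X_k`). -/
noncomputable def Xop (m : ℤ × ℤ) (k : ℤ × ℤ) (g : NN m) : NN m :=
  if h : k = m then XmZ m 1 g
  else Finsupp.mapRange (fun a => X (⟨k, h⟩ : NVar m) * a) (by simp) g

/-- The partial derivative `∂_s` on `N` (with `∂_m x_m^k = k x_m^{k−1}`, `k ∈ ℤ`). -/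
noncomputable def Dop (m : ℤ × ℤ) (s : ℤ × ℤ) (g : NN m) : NN m :=
  if h : s = m then g.sum (fun k a => Finsupp.single (k - 1) (k • a))
  else Finsupp.mapRange (fun a => pderiv (⟨s, h⟩ : NVar m) a) (by simp) g

/-- A finite set of indices containing every `s` for which `∂_s` acts nonzero on `g`
(together with `m`); sums over all `s ∈ ℤ²` in the defining formulas reduce to sums
over this finite set. -/
noncomputable def nvars (m : ℤ × ℤ) (g : NN m) : Finset (ℤ × ℤ) :=
  insert m (g.support.biUnion fun k => (g k).vars.image Subtype.val)

/-- `E21(n)` on `N`: multiplication by `x_n`. -/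
noncomputable def E21N (m n : ℤ × ℤ) (g : NN m) : NN m := Xop m n g

/-- `E22(n) = Σ_s q^{s₁n₂} x_{n+s} ∂_s` on `N`. -/
noncomputable def E22N (q : ℂ) (m n : ℤ × ℤ) (g : NN m) : NN m :=
  ∑ s ∈ nvars m g, q ^ (s.1 * n.2) • Xop m (n + s) (Dop m s g)

/-- `E11(n) = δ_{n,0} μ id − Σ_s q^{s₂n₁} x_{n+s} ∂_s` on `N`. -/
noncomputable def E11N (q μ : ℂ) (m n : ℤ × ℤ) (g : NN m) : NN m :=
  (if n = 0 then μ • g else 0) - ∑ s ∈ nvars m g, q ^ (s.2 * n.1) • Xop m (n + s) (Dop m s g)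

/-- `E12(n) = q^{−n₁n₂} μ ∂_{−n} − Σ_{s,r} q^{n₂r₁+s₂n₁+s₂r₁} x_{n+s+r} ∂_s ∂_r` on `N`. -/
noncomputable def E12N (q μ : ℂ) (m n : ℤ × ℤ) (g : NN m) : NN m :=
  q ^ (-(n.1 * n.2)) • μ • Dop m (-n) g -
    ∑ s ∈ nvars m g, ∑ r ∈ nvars m g,
      q ^ (n.2 * r.1 + s.2 * n.1 + s.2 * r.1) • Xop m (n + s + r) (Dop m s (Dop m r g))

/-- `𝓔_m = Σ_{s,r} q^{−m₂r₁−s₂m₁+s₂r₁} x_{−m+s+r} ∂_s ∂_r` on `N`. -/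
noncomputable def EmN (q : ℂ) (m : ℤ × ℤ) (g : NN m) : NN m :=
  ∑ s ∈ nvars m g, ∑ r ∈ nvars m g,
    q ^ (-(m.2 * r.1) - s.2 * m.1 + s.2 * r.1) • Xop m (-m + s + r) (Dop m s (Dop m r g))

/-- `D1 = Σ_s s₁ x_s ∂_s` on `N`. -/
noncomputable def D1N (m : ℤ × ℤ) (g : NN m) : NN m :=
  ∑ s ∈ nvars m g, (s.1 : ℂ) • Xop m s (Dop m s g)

/-- `D2 = Σ_s s₂ x_s ∂_s` on `N`. -/
noncomputable def D2N (m : ℤ × ℤ) (g : NN m) : NN m :=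
  ∑ s ∈ nvars m g, (s.2 : ℂ) • Xop m s (Dop m s g)

/-- The `b`-twisted operator `Ẽ12(n)` on `N`. -/
noncomputable def tE12 (q μ : ℂ) (m : ℤ × ℤ) (b : ℂ) (n : ℤ × ℤ) (g : NN m) : NN m :=
  E12N q μ m n g
    + b • (q ^ (m.2 * n.1) • E22N q m (m + n) (XmZ m (-1) g)
           - q ^ (m.1 * n.2) • E11N q μ m (m + n) (XmZ m (-1) g))
    - (b * (b - 1) * q ^ (m.2 * n.1 + m.2 * m.1 + m.1 * n.2)) •
        Xop m (m + m + n) (XmZ m (-1) (XmZ m (-1) g))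

/-- The `b`-twisted operator `Ẽ11(n)` on `N`. -/
noncomputable def tE11 (q μ : ℂ) (m : ℤ × ℤ) (b : ℂ) (n : ℤ × ℤ) (g : NN m) : NN m :=
  E11N q μ m n g + (b * q ^ (m.2 * n.1)) • Xop m (m + n) (XmZ m (-1) g)

/-- The `b`-twisted operator `Ẽ22(n)` on `N`. -/
noncomputable def tE22 (q : ℂ) (m : ℤ × ℤ) (b : ℂ) (n : ℤ × ℤ) (g : NN m) : NN m :=
  E22N q m n g - (b * q ^ (m.1 * n.2)) • Xop m (m + n) (XmZ m (-1) g)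

/-- The `b`-twisted operator `D̃1 = D1 − b m₁ id` on `N`. -/
noncomputable def tD1 (m : ℤ × ℤ) (b : ℂ) (g : NN m) : NN m := D1N m g - (b * (m.1 : ℂ)) • g

/-- The `b`-twisted operator `D̃2 = D2 − b m₂ id` on `N`. -/
noncomputable def tD2 (m : ℤ × ℤ) (b : ℂ) (g : NN m) : NN m := D2N m g - (b * (m.2 : ℂ)) • g

lemma XmZ_add (m : ℤ × ℤ) (j : ℤ) (f g : NN m) : XmZ m j (f + g) = XmZ m j f + XmZ m j g :=
  Finsupp.mapDomain_add

lemma XmZ_smul (m : ℤ × ℤ) (j : ℤ) (c : ℂ) (g : NN m) : XmZ m j (c • g) = c • XmZ m j g :=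
  Finsupp.mapDomain_smul c g

/-- `XmZ` as a linear map. -/
noncomputable def XmZLin (m : ℤ × ℤ) (j : ℤ) : NN m →ₗ[ℂ] NN m where
  toFun := XmZ m j
  map_add' := XmZ_add m j
  map_smul' := XmZ_smul m j

lemma XmZ_apply (m : ℤ × ℤ) (j : ℤ) (g : NN m) (k : ℤ) : XmZ m j g k = g (k - j) := by
  have h := Finsupp.mapDomain_apply (add_left_injective j) g (k - j)
  simpa [XmZ] using h

lemma Dop_self_apply (m : ℤ × ℤ) (g : NN m) (k : ℤ) :
    Dop m m g k = (k + 1) • g (k + 1) := by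
  classical
  simp only [Dop, dif_pos]
  rw [Finsupp.sum_apply, Finsupp.sum, Finset.sum_eq_single (k + 1)]
  · simp
  · intro l _ hl
    rw [Finsupp.single_apply, if_neg]
    omega
  · intro h
    simp [Finsupp.notMem_support_iff.mp h]

lemma Dop_apply_of_ne {m s : ℤ × ℤ} (h : s ≠ m) (g : NN m) (k : ℤ) :
    Dop m s g k = pderiv (⟨s, h⟩ : NVar m) (g k) := by
  simp [Dop, h]

lemma Xop_self (m : ℤ × ℤ) (g : NN m) : Xop m m g = XmZ m 1 g := by
  simp [Xop]

lemma Xop_apply_of_ne {m s : ℤ × ℤ} (h : s ≠ m) (g : NN m) (k : ℤ) :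
    Xop m s g k = X (⟨s, h⟩ : NVar m) * g k := by
  simp [Xop, h]

/-- `Dop` as a linear map. -/
noncomputable def DopLin (m s : ℤ × ℤ) : NN m →ₗ[ℂ] NN m where
  toFun := Dop m s
  map_add' f g := by
    ext1 k
    by_cases h : s = m
    · subst h; simp [Dop_self_apply]
    · simp [Dop_apply_of_ne h]
  map_smul' c g := by
    ext1 k
    by_cases h : s = m
    · subst h; simp [Dop_self_apply]
    · simp [Dop_apply_of_ne h]

/-- `Xop` as a linear map. -/
noncomputable def XopLin (m s : ℤ × ℤ) : NN m →ₗ[ℂ] NN m where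
  toFun := Xop m s
  map_add' f g := by
    ext1 k
    by_cases h : s = m
    · subst h; simp [Xop_self, XmZ_apply]
    · simp [Xop_apply_of_ne h, mul_add]
  map_smul' c g := by
    ext1 k
    by_cases h : s = m
    · subst h; simp [Xop_self, XmZ_apply]
    · simp [Xop_apply_of_ne h]

lemma Xop_XmZ (m s : ℤ × ℤ) (j : ℤ) (g : NN m) : Xop m s (XmZ m j g) = XmZ m j (Xop m s g) := by
  ext1 k
  by_cases h : s = m
  · subst h; simp only [Xop_self, XmZ_apply]; congr 1; ring
  · simp only [Xop_apply_of_ne h, XmZ_apply]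

lemma Xop_self_XmZ_neg_one (m : ℤ × ℤ) (g : NN m) : Xop m m (XmZ m (-1) g) = g := by
  ext1 k
  simp [Xop_self, XmZ_apply]

lemma Dop_XmZ_neg_one (m s : ℤ × ℤ) (g : NN m) :
    Dop m s (XmZ m (-1) g) =
      XmZ m (-1) (Dop m s g) - (if s = m then (1 : ℂ) else 0) • XmZ m (-1) (XmZ m (-1) g) := by
  ext1 k
  by_cases h : s = m
  · subst h
    simp only [Dop_self_apply, XmZ_apply, if_true, one_smul, Finsupp.sub_apply, sub_neg_eq_add]
    module
  · simp [Dop_apply_of_ne h, XmZ_apply, h]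

lemma nvars_XmZ (m : ℤ × ℤ) (j : ℤ) (g : NN m) : nvars m (XmZ m j g) = nvars m g := by
  unfold nvars
  congr 1
  ext s
  simp only [Finset.mem_biUnion, Finsupp.mem_support_iff, XmZ_apply]
  constructor
  · rintro ⟨k, hk⟩
    exact ⟨k - j, hk⟩
  · rintro ⟨k, hk⟩
    exact ⟨k + j, by simpa using hk⟩

lemma self_mem_nvars (m : ℤ × ℤ) (g : NN m) : m ∈ nvars m g :=
  Finset.mem_insert_self _ _

/-- The Euler operator `Σ_{s ∈ S} x_s ∂_s`. -/
noncomputable def eulerLin (m : ℤ × ℤ) (S : Finset (ℤ × ℤ)) : NN m →ₗ[ℂ] NN m :=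
  ∑ s ∈ S, XopLin m s ∘ₗ DopLin m s

lemma eulerLin_apply (m : ℤ × ℤ) (S : Finset (ℤ × ℤ)) (g : NN m) :
    eulerLin m S g = ∑ s ∈ S, Xop m s (Dop m s g) := by
  simp [eulerLin, XopLin, DopLin]

/-- The second-order part of `E12(-m)`, with both sums restricted to `S`. -/
noncomputable def quadLin (q : ℂ) (m : ℤ × ℤ) (S : Finset (ℤ × ℤ)) : NN m →ₗ[ℂ] NN m :=
  ∑ s ∈ S, ∑ r ∈ S, q ^ (-m.2 * r.1 + s.2 * -m.1 + s.2 * r.1) •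
    (XopLin m (-m + s + r) ∘ₗ DopLin m s ∘ₗ DopLin m r)

lemma XopLin_XmZLin (m s : ℤ × ℤ) (j : ℤ) (g : NN m) :
    XopLin m s (XmZLin m j g) = XmZLin m j (XopLin m s g) := Xop_XmZ m s j g

lemma XopLin_self_XmZLin (m : ℤ × ℤ) (g : NN m) : XopLin m m (XmZLin m (-1) g) = g :=
  Xop_self_XmZ_neg_one m g

lemma DopLin_XmZLin (m s : ℤ × ℤ) (g : NN m) :
    DopLin m s (XmZLin m (-1) g) = XmZLin m (-1) (DopLin m s g) -
      (if s = m then (1 : ℂ) else 0) • XmZLin m (-1) (XmZLin m (-1) g) :=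
  Dop_XmZ_neg_one m s g

lemma eulerLin_XmZLin (m : ℤ × ℤ) {S : Finset (ℤ × ℤ)} (hS : m ∈ S) (g : NN m) :
    eulerLin m S (XmZLin m (-1) g) = XmZLin m (-1) (eulerLin m S g) - XmZLin m (-1) g := by
  have key : ∀ s, XopLin m s (DopLin m s (XmZLin m (-1) g)) =
      XmZLin m (-1) (XopLin m s (DopLin m s g)) - if s = m then XmZLin m (-1) g else 0 := by
    intro s
    by_cases h : s = m
    · subst h
      rw [DopLin_XmZLin, map_sub, if_pos rfl, if_pos rfl, one_smul,
        XopLin_XmZLin s s (-1) (DopLin s s g), XopLin_self_XmZLin]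
    · simp [DopLin_XmZLin, XopLin_XmZLin, h]
  simp [eulerLin, key, Finset.sum_sub_distrib, hS]

lemma quadLin_XmZLin (q : ℂ) (m : ℤ × ℤ) {S : Finset (ℤ × ℤ)} (hS : m ∈ S)
    (g : NN m) :
    quadLin q m S (XmZLin m (-1) g) = XmZLin m (-1) (quadLin q m S g) -
      (2 * q ^ (-(m.1 * m.2))) • (XmZLin m (-1) (XmZLin m (-1) (eulerLin m S g)) -
        XmZLin m (-1) (XmZLin m (-1) g)) := by
  set U := XmZLin m (-1) with hU
  have key : ∀ s r : ℤ × ℤ,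
      q ^ (-m.2 * r.1 + s.2 * -m.1 + s.2 * r.1) •
        XopLin m (-m + s + r) (DopLin m s (DopLin m r (U g))) =
      q ^ (-m.2 * r.1 + s.2 * -m.1 + s.2 * r.1) •
        U (XopLin m (-m + s + r) (DopLin m s (DopLin m r g))) -
      (if s = m then q ^ (-(m.1 * m.2)) • U (U (XopLin m r (DopLin m r g))) else 0) -
      (if r = m then q ^ (-(m.1 * m.2)) • U (U (XopLin m s (DopLin m s g))) else 0) +
      (if s = m then if r = m then (2 * q ^ (-(m.1 * m.2))) • U (U g) else 0 else 0) := by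
    intro s r
    have e1 : -m.2 * r.1 + m.2 * -m.1 + m.2 * r.1 = -(m.1 * m.2) := by ring
    have e2 : -m.2 * m.1 + s.2 * -m.1 + s.2 * m.1 = -(m.1 * m.2) := by ring
    have hX : XopLin m m (U (U (U g))) = U (U g) := XopLin_self_XmZLin m _
    by_cases hs : s = m <;> by_cases hr : r = m
    · subst hs hr
      simp only [hU, DopLin_XmZLin, map_sub, if_true, one_smul, neg_add_cancel, zero_add,
        e1, XopLin_XmZLin] at hX ⊢
      rw [hX]
      module
    · subst hs
      simp only [hU, DopLin_XmZLin, map_sub, if_true, one_smul, neg_add_cancel, zero_add,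
        e1, XopLin_XmZLin, if_neg hr, zero_smul, sub_zero, add_zero]
      module
    · subst hr
      have e3 : -r + s + r = s := by abel
      simp only [hU, DopLin_XmZLin, map_sub, if_true, one_smul, e3,
        e2, XopLin_XmZLin, if_neg hs, zero_smul, sub_zero, add_zero]
      module
    · simp only [hU, DopLin_XmZLin, if_neg hs, if_neg hr, zero_smul, sub_zero, add_zero,
        XopLin_XmZLin]
  simp only [quadLin, eulerLin, LinearMap.sum_apply, LinearMap.smul_apply, LinearMap.comp_apply,
    key, Finset.sum_add_distrib, Finset.sum_sub_distrib, map_sum, map_smul]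
  have h1 : ∀ F : ℤ × ℤ → NN m,
      ∑ s ∈ S, ∑ r ∈ S, (if s = m then F r else 0) = ∑ r ∈ S, F r := by
    intro F
    rw [Finset.sum_comm]
    simp [hS]
  rw [h1 fun r => q ^ (-(m.1 * m.2)) • U (U (XopLin m r (DopLin m r g))),
    h1 fun r => if r = m then (2 * q ^ (-(m.1 * m.2))) • U (U g) else 0]
  simp only [Finset.sum_ite_eq', hS, if_true, ← Finset.smul_sum]
  module

lemma E22N_zero (q : ℂ) (m : ℤ × ℤ) (g : NN m) :
    E22N q m 0 g = eulerLin m (nvars m g) g := by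
  simp [E22N, eulerLin_apply]

lemma E11N_zero (q μ : ℂ) (m : ℤ × ℤ) (g : NN m) :
    E11N q μ m 0 g = μ • g - eulerLin m (nvars m g) g := by
  simp [E11N, eulerLin_apply]

lemma E12N_neg_self (q μ : ℂ) (m : ℤ × ℤ) (g : NN m) :
    E12N q μ m (-m) g =
      q ^ (-(m.1 * m.2)) • μ • DopLin m m g - quadLin q m (nvars m g) g := by
  simp [E12N, quadLin, DopLin, XopLin]

lemma tE12_neg_self (q μ : ℂ) (m : ℤ × ℤ) (b : ℂ) (g : NN m) :
    tE12 q μ m b (-m) g =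
      q ^ (-(m.1 * m.2)) • μ • DopLin m m g - quadLin q m (nvars m g) g +
        (b * q ^ (-(m.1 * m.2))) • ((2 : ℂ) • eulerLin m (nvars m g) (XmZLin m (-1) g) -
          μ • XmZLin m (-1) g) -
        (b * (b - 1) * q ^ (-(m.1 * m.2))) • XmZLin m (-1) g := by
  have hX : Xop m m (XmZ m (-1) (XmZ m (-1) g)) = XmZLin m (-1) g := Xop_self_XmZ_neg_one m _
  have hU : XmZ m (-1) g = XmZLin m (-1) g := rfl
  have e1 : m.2 * (-m).1 = -(m.1 * m.2) := by simp [mul_comm]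
  have e2 : m.1 * (-m).2 = -(m.1 * m.2) := by simp
  have e3 : m.2 * (-m).1 + m.2 * m.1 + m.1 * (-m).2 = -(m.1 * m.2) := by
    simp only [Prod.fst_neg, Prod.snd_neg]; ring
  rw [tE12, e3, e1, e2, add_neg_cancel, add_neg_cancel_right, E12N_neg_self, E22N_zero, E11N_zero,
    hX, nvars_XmZ, hU]
  module

lemma tE11_zero_sub_tE22_zero (q μ : ℂ) (m : ℤ × ℤ) (b : ℂ) (g : NN m) :
    tE11 q μ m b 0 (XmZ m (-1) g) - tE22 q m b 0 (XmZ m (-1) g) =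
      μ • XmZLin m (-1) g - (2 : ℂ) • eulerLin m (nvars m g) (XmZLin m (-1) g) +
        (2 * b) • XmZLin m (-1) g := by
  have hX : Xop m m (XmZ m (-1) (XmZ m (-1) g)) = XmZLin m (-1) g := Xop_self_XmZ_neg_one m _
  have hU : XmZ m (-1) g = XmZLin m (-1) g := rfl
  rw [tE11, tE22, add_zero, hX, E22N_zero, E11N_zero, nvars_XmZ, hU]
  simp only [Prod.fst_zero, Prod.snd_zero, mul_zero, zpow_zero, mul_one]
  module

/-- `X_m^{−1}∘Ẽ12(−m) − Ẽ12(−m)∘X_m^{−1}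
= q^{−m₁m₂} X_m^{−1}∘(Ẽ11(0) − Ẽ22(0))∘X_m^{−1}` as operators on `N`. -/
theorem stmt17 (q μ : ℂ) (hq : q ≠ 0) (m : ℤ × ℤ) (b : ℂ) :
    ∀ g : NN m,
      XmZ m (-1) (tE12 q μ m b (-m) g) - tE12 q μ m b (-m) (XmZ m (-1) g) =
        q ^ (-(m.1 * m.2)) •
          XmZ m (-1) (tE11 q μ m b 0 (XmZ m (-1) g) - tE22 q m b 0 (XmZ m (-1) g)) := by
  intro g
  have hS := self_mem_nvars m g
  have hU : ∀ f, XmZ m (-1) f = XmZLin m (-1) f := fun _ => rfl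
  rw [tE11_zero_sub_tE22_zero, tE12_neg_self, tE12_neg_self, nvars_XmZ]
  simp only [hU, quadLin_XmZLin q m hS, eulerLin_XmZLin m hS, DopLin_XmZLin, map_add, map_sub,
    map_smul, if_true, one_smul]
  module
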